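/- Let A be a commutative complex Banach algebra with unit. Every unit a of the Wiener algebra W(A) admits a factorization a = a⁻ * ã * a⁺, where a⁻ is a strictly antiholomorphic unit of W(A), ã is an orthogonal unit of W(A), and a⁺ is a strictly holomorphic unit of W(A). -/

import Mathlib

open scoped BigOperators

/-- A function `a : ℤ → A` is rapidly decreasing if for every `k` the quantities
`(1+|n|)^k * ‖a n‖` are bounded. -/
def RapidlyDecreasing {A : Type*} [NormedRing A] (a : ℤ → A) : Prop :=
  ∀ k : ℕ, ∃ C : ℝ, ∀ n : ℤ, (1 + |(n : ℝ)|) ^ k * ‖a n‖ ≤ C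

/-- The convolution product of the Wiener algebra `W(A)`:
`(a*b)(n) = ∑_{m∈ℤ} a(m)·b(n−m)`. -/
noncomputable def conv {A : Type*} [NormedRing A] (a b : ℤ → A) : ℤ → A :=
  fun n => ∑' m : ℤ, a m * b (n - m)

/-- The multiplicative unit `e` of the Wiener algebra: `e(0)=1`, `e(n)=0` for `n≠0`. -/
def wone {A : Type*} [NormedRing A] : ℤ → A := fun n => if n = 0 then 1 else 0

/-- `a` is a unit of the Wiener algebra `W(A)`. -/
def IsWienerUnit {A : Type*} [NormedRing A] (a : ℤ → A) : Prop :=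
  RapidlyDecreasing a ∧ ∃ b : ℤ → A, RapidlyDecreasing b ∧ conv a b = wone

/-- `a` is strictly holomorphic: `a(0)=1` and `a(n)=0` for `n<0`. -/
def StrictlyHolomorphic {A : Type*} [NormedRing A] (a : ℤ → A) : Prop :=
  a 0 = 1 ∧ ∀ n : ℤ, n < 0 → a n = 0

/-- `a` is strictly antiholomorphic: `a(0)=1` and `a(n)=0` for `n>0`. -/
def StrictlyAntiholomorphic {A : Type*} [NormedRing A] (a : ℤ → A) : Prop :=
  a 0 = 1 ∧ ∀ n : ℤ, 0 < n → a n = 0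

/-- `a` is an orthogonal Laurent series: `a(n)·a(m)=0` whenever `n≠m`. -/
def OrthogonalSeq {A : Type*} [NormedRing A] (a : ℤ → A) : Prop :=
  ∀ n m : ℤ, n ≠ m → a n * a m = 0

namespace RapidlyDecreasing

variable {A : Type*} [NormedRing A] {f g : ℤ → A}

theorem summable (hf : RapidlyDecreasing f) (k : ℕ) :
    Summable fun n : ℤ => (1 + |(n : ℝ)|) ^ k * ‖f n‖ := by
  obtain ⟨C, hC⟩ := hf (k + 2)
  have hs : Summable fun n : ℤ => C * (1 / (1 + |(n : ℝ)|) ^ 2) := by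
    refine Summable.mul_left C ?_
    have h : Summable fun n : ℕ => 1 / (1 + (n : ℝ)) ^ 2 := by
      have := (summable_nat_add_iff 1).2 (Real.summable_one_div_nat_pow.2 one_lt_two)
      refine this.congr fun n => ?_
      push_cast
      ring
    exact Summable.of_nat_of_neg (by simpa using h) (by simpa using h)
  refine Summable.of_nonneg_of_le (fun n => by positivity) (fun n => ?_) hs
  have h1 : (0 : ℝ) < (1 + |(n : ℝ)|) ^ 2 := by positivity
  rw [mul_one_div, le_div_iff₀ h1]
  calc _ = (1 + |(n : ℝ)|) ^ (k + 2) * ‖f n‖ := by ring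
    _ ≤ C := hC n

theorem of_summable
    (h : ∀ k : ℕ, Summable fun n : ℤ => (1 + |(n : ℝ)|) ^ k * ‖f n‖) : RapidlyDecreasing f :=
  fun k => ⟨_, fun n => (h k).le_tsum n fun _ _ => by positivity⟩

theorem summable_norm (hf : RapidlyDecreasing f) : Summable fun n => ‖f n‖ := by
  simpa using hf.summable 0

theorem zero : RapidlyDecreasing (0 : ℤ → A) := fun _ => ⟨0, by simp⟩

theorem single (x : A) : RapidlyDecreasing fun n : ℤ => if n = 0 then x else 0 := by
  refine fun k => ⟨‖x‖, fun n => ?_⟩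
  by_cases hn : n = 0 <;> simp [hn]

theorem add (hf : RapidlyDecreasing f) (hg : RapidlyDecreasing g) :
    RapidlyDecreasing (f + g) := by
  intro k
  obtain ⟨C, hC⟩ := hf k
  obtain ⟨D, hD⟩ := hg k
  refine ⟨C + D, fun n => ?_⟩
  calc _ ≤ (1 + |(n : ℝ)|) ^ k * (‖f n‖ + ‖g n‖) := by gcongr; exact norm_add_le _ _
    _ ≤ _ := by rw [mul_add]; exact add_le_add (hC n) (hD n)

theorem neg (hf : RapidlyDecreasing f) : RapidlyDecreasing (-f) := fun k => by
  simpa using hf k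

theorem reflect (hf : RapidlyDecreasing f) : RapidlyDecreasing fun n => f (-n) := fun k => by
  obtain ⟨C, hC⟩ := hf k
  exact ⟨C, fun n => by simpa using hC (-n)⟩

theorem mono (hg : RapidlyDecreasing g) (h : ∀ n, ‖f n‖ ≤ ‖g n‖) : RapidlyDecreasing f :=
  fun k => by
    obtain ⟨C, hC⟩ := hg k
    exact ⟨C, fun n => le_trans (by gcongr; exact h n) (hC n)⟩

theorem deriv [NormedAlgebra ℂ A] (hf : RapidlyDecreasing f) :
    RapidlyDecreasing fun n => (n : ℂ) • f n := fun k => by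
  obtain ⟨C, hC⟩ := hf (k + 1)
  refine ⟨C, fun n => le_trans ?_ (hC n)⟩
  rw [norm_smul, Complex.norm_intCast, pow_succ, mul_assoc]
  gcongr
  linarith

theorem summable_prod (hf : RapidlyDecreasing f) (hg : RapidlyDecreasing g) (k : ℕ) :
    Summable fun p : ℤ × ℤ => (1 + |(p.2 : ℝ)|) ^ k * ‖f p.2‖ *
      ((1 + |((p.1 - p.2 : ℤ) : ℝ)|) ^ k * ‖g (p.1 - p.2)‖) := by
  have h := (hf.summable k).mul_of_nonneg (hg.summable k)
    (fun _ => by positivity) (fun _ => by positivity)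
  have hi : Function.Injective fun p : ℤ × ℤ => (p.2, p.1 - p.2) := by
    rintro ⟨a, b⟩ ⟨c, d⟩ h
    simp only [Prod.mk.injEq] at h ⊢
    lia
  simpa only [Function.comp_def] using h.comp_injective hi

theorem conv (hf : RapidlyDecreasing f) (hg : RapidlyDecreasing g) :
    RapidlyDecreasing (conv f g) := by
  refine of_summable fun k => ?_
  have hs := hf.summable_prod hg k
  refine Summable.of_nonneg_of_le (fun _ => by positivity) (fun n => ?_) hs.prod
  have hsn := hs.prod_factor n
  have hw : ∀ m : ℤ, (1 + |(n : ℝ)|) ^ k * ‖f m * g (n - m)‖ ≤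
      (1 + |(m : ℝ)|) ^ k * ‖f m‖ * ((1 + |((n - m : ℤ) : ℝ)|) ^ k * ‖g (n - m)‖) := by
    intro m
    have h1 : 1 + |(n : ℝ)| ≤ (1 + |(m : ℝ)|) * (1 + |((n - m : ℤ) : ℝ)|) := by
      have h2 : |(n : ℝ)| ≤ |(m : ℝ)| + |((n - m : ℤ) : ℝ)| := by
        refine le_trans (le_of_eq ?_) (abs_add_le _ _)
        push_cast
        ring_nf
      nlinarith [abs_nonneg (m : ℝ), abs_nonneg ((n - m : ℤ) : ℝ)]
    calc _ ≤ ((1 + |(m : ℝ)|) * (1 + |((n - m : ℤ) : ℝ)|)) ^ k * (‖f m‖ * ‖g (n - m)‖) := by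
          gcongr
          exact norm_mul_le _ _
      _ = _ := by rw [mul_pow]; ring
  have hb : Summable fun m : ℤ => (1 + |(n : ℝ)|) ^ k * ‖f m * g (n - m)‖ :=
    Summable.of_nonneg_of_le (fun _ => by positivity) hw hsn
  have hn : Summable fun m : ℤ => ‖f m * g (n - m)‖ :=
    (summable_mul_left_iff (by positivity)).1 hb
  calc _ ≤ (1 + |(n : ℝ)|) ^ k * ∑' m, ‖f m * g (n - m)‖ := by
        gcongr
        exact norm_tsum_le_tsum_norm hn
    _ = ∑' m, (1 + |(n : ℝ)|) ^ k * ‖f m * g (n - m)‖ := (tsum_mul_left).symm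
    _ ≤ _ := Summable.tsum_le_tsum hw hb hsn

variable [CompleteSpace A]

theorem summable_conv (hf : RapidlyDecreasing f) (hg : RapidlyDecreasing g) (n : ℤ) :
    Summable fun m => f m * g (n - m) := by
  obtain ⟨C, hC⟩ := hg 0
  refine Summable.of_norm_bounded (hf.summable_norm.mul_right C) fun m => ?_
  refine (norm_mul_le _ _).trans ?_
  gcongr
  simpa using hC (n - m)

end RapidlyDecreasing

theorem conv_comm {A : Type*} [NormedCommRing A] (f g : ℤ → A) : conv f g = conv g f := by
  ext n
  rw [conv, conv, ← (Equiv.subLeft n).tsum_eq]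
  simp [mul_comm]

theorem conv_assoc {A : Type*} [NormedRing A] [CompleteSpace A] {f g h : ℤ → A}
    (hf : RapidlyDecreasing f) (hg : RapidlyDecreasing g) (hh : RapidlyDecreasing h) :
    conv (conv f g) h = conv f (conv g h) := by
  ext n
  have hs : Summable (Function.uncurry fun m j : ℤ => f j * g (m - j) * h (n - m)) := by
    obtain ⟨C, hC⟩ := hh 0
    refine Summable.of_norm_bounded ((hf.summable_prod hg 0).mul_right C) fun p => ?_
    simp only [Function.uncurry, pow_zero, one_mul]
    refine (norm_mul_le _ _).trans ?_
    gcongr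
    · exact norm_mul_le _ _
    · simpa using hC (n - p.1)
  calc conv (conv f g) h n = ∑' m, ∑' j, f j * g (m - j) * h (n - m) :=
        tsum_congr fun m => ((hf.summable_conv hg m).tsum_mul_right _).symm
    _ = ∑' j, ∑' m, f j * g (m - j) * h (n - m) := hs.tsum_comm.symm
    _ = conv f (conv g h) n := tsum_congr fun j => by
        rw [conv, ← (hg.summable_conv hh _).tsum_mul_left, ← (Equiv.addRight j).tsum_eq]
        refine tsum_congr fun m => ?_
        simp only [Equiv.coe_addRight, add_sub_cancel_right, mul_assoc]
        congr 3
        ring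

/-- The Wiener algebra of rapidly decreasing functions `ℤ → A`. -/
structure WienerAlgebra (A : Type*) [NormedRing A] where
  /-- The underlying function. -/
  toFun : ℤ → A
  /-- The underlying function is rapidly decreasing. -/
  rapidlyDecreasing : RapidlyDecreasing toFun

namespace WienerAlgebra

variable {A : Type*} [NormedCommRing A]

instance : CoeFun (WienerAlgebra A) fun _ => ℤ → A := ⟨toFun⟩

@[ext]
theorem ext {f g : WienerAlgebra A} (h : ∀ n, f n = g n) : f = g := by
  cases f
  cases g
  congr
  exact funext h

/-- The constant Laurent series with value `x`. -/
def const (x : A) : WienerAlgebra A := ⟨_, RapidlyDecreasing.single x⟩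

/-- The reflection `n ↦ f (-n)`. -/
def reflect (f : WienerAlgebra A) : WienerAlgebra A := ⟨_, f.2.reflect⟩

/-- The part of `f` supported on positive indices. -/
noncomputable def posPart (f : WienerAlgebra A) : WienerAlgebra A :=
  ⟨fun n => if 0 < n then f n else 0, f.2.mono fun n => by split_ifs <;> simp⟩

/-- The derivation `n ↦ n • f n`. -/
noncomputable def deriv [NormedAlgebra ℂ A] (f : WienerAlgebra A) : WienerAlgebra A :=
  ⟨_, f.2.deriv⟩

instance : Zero (WienerAlgebra A) := ⟨⟨0, .zero⟩⟩

noncomputable instance : One (WienerAlgebra A) := ⟨⟨wone, .single 1⟩⟩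

instance : Add (WienerAlgebra A) := ⟨fun f g => ⟨f + g, f.2.add g.2⟩⟩

instance : Neg (WienerAlgebra A) := ⟨fun f => ⟨-f, f.2.neg⟩⟩

noncomputable instance : Mul (WienerAlgebra A) := ⟨fun f g => ⟨conv f g, f.2.conv g.2⟩⟩

theorem mul_apply (f g : WienerAlgebra A) (n : ℤ) : (f * g) n = ∑' m : ℤ, f m * g (n - m) := rfl

theorem one_apply (n : ℤ) : (1 : WienerAlgebra A) n = if n = 0 then 1 else 0 := rfl

@[simp]
theorem add_apply (f g : WienerAlgebra A) (n : ℤ) : (f + g) n = f n + g n := rfl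

@[simp]
theorem neg_apply (f : WienerAlgebra A) (n : ℤ) : (-f) n = -f n := rfl

@[simp]
theorem reflect_apply (f : WienerAlgebra A) (n : ℤ) : f.reflect n = f (-n) := rfl

theorem posPart_apply (f : WienerAlgebra A) (n : ℤ) :
    f.posPart n = if 0 < n then f n else 0 := rfl

theorem const_apply (x : A) (n : ℤ) : const x n = if n = 0 then x else 0 := rfl

@[simp]
theorem deriv_apply [NormedAlgebra ℂ A] (f : WienerAlgebra A) (n : ℤ) :
    f.deriv n = (n : ℂ) • f n := rfl

theorem reflect_one : (1 : WienerAlgebra A).reflect = 1 := by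
  ext n
  simp [one_apply]

theorem const_mul_apply (x : A) (f : WienerAlgebra A) (n : ℤ) : (const x * f) n = x * f n := by
  rw [mul_apply, tsum_eq_single 0 fun m hm => by simp [const_apply, hm]]
  simp [const_apply]

theorem reflect_mul (f g : WienerAlgebra A) : (f * g).reflect = f.reflect * g.reflect := by
  ext n
  rw [reflect_apply, mul_apply, mul_apply, ← (Equiv.neg ℤ).tsum_eq]
  refine tsum_congr fun m => ?_
  simp only [Equiv.neg_apply, reflect_apply]
  congr 2
  ring

theorem mul_apply_zero_of_neg {f g : WienerAlgebra A} (hf : ∀ n < 0, f n = 0)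
    (hg : ∀ n < 0, g n = 0) : (f * g) 0 = f 0 * g 0 := by
  rw [mul_apply, tsum_eq_single 0 fun m hm => ?_]
  · simp
  · rcases lt_or_gt_of_ne hm with h | h
    · rw [hf m h, zero_mul]
    · rw [hg (0 - m) (by lia), mul_zero]

theorem posPart_add_reflect_posPart (f : WienerAlgebra A) :
    f.posPart + const (f 0) + f.reflect.posPart.reflect = f := by
  ext n
  rcases lt_trichotomy n 0 with h | rfl | h
  · simp [posPart_apply, const_apply, h, h.ne, h.le]
  · simp [posPart_apply, const_apply]
  · simp [posPart_apply, const_apply, h, h.ne', h.le]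

theorem deriv_reflect [NormedAlgebra ℂ A] (f : WienerAlgebra A) :
    f.reflect.deriv = -f.deriv.reflect := by
  ext n
  simp

/-- The Taylor coefficients of the solution of `z y' = d y`, `y(0) = 1`, for `d` a power series
without constant term. -/
noncomputable def expCoeff [NormedAlgebra ℂ A] (d : ℤ → A) : ℕ → A
  | 0 => 1
  | n + 1 => ((n : ℂ) + 1)⁻¹ • ∑ j : Fin (n + 1), expCoeff d j * d (n + 1 - (j : ℕ))

theorem smul_expCoeff [NormedAlgebra ℂ A] (d : ℤ → A) (n : ℕ) :
    (n : ℂ) • expCoeff d n = ∑ j ∈ Finset.range n, expCoeff d j * d (n - j) := by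
  cases n with
  | zero => simp
  | succ n =>
    have h : (n : ℂ) + 1 ≠ 0 := by exact_mod_cast n.succ_ne_zero
    rw [expCoeff, Nat.cast_succ, smul_inv_smul₀ h,
      ← Fin.sum_univ_eq_sum_range fun j : ℕ => expCoeff d j * d (((n + 1 : ℕ) : ℤ) - j)]
    simp

theorem norm_expCoeff_le [NormedAlgebra ℂ A] (d : WienerAlgebra A) (k n : ℕ) {K : ℝ} (hK0 : 0 ≤ K)
    (hK : ∀ j < n, (1 + (j : ℝ)) ^ k * ‖expCoeff d j‖ ≤ K) :
    n * ((1 + (n : ℝ)) ^ k * ‖expCoeff d n‖) ≤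
      K * ∑' m : ℤ, (1 + |(m : ℝ)|) ^ k * ‖d m‖ := by
  have hs := d.2.summable k
  calc (n : ℝ) * ((1 + (n : ℝ)) ^ k * ‖expCoeff d n‖)
      = (1 + (n : ℝ)) ^ k * ‖(n : ℂ) • expCoeff d n‖ := by
        rw [norm_smul, Complex.norm_natCast]
        ring
    _ ≤ (1 + (n : ℝ)) ^ k * ∑ j ∈ Finset.range n, ‖expCoeff d j‖ * ‖d (n - j)‖ := by
        rw [smul_expCoeff]
        gcongr
        exact norm_sum_le_of_le _ fun j _ => norm_mul_le _ _
    _ ≤ ∑ j ∈ Finset.range n, K * ((1 + |((n - j : ℤ) : ℝ)|) ^ k * ‖d (n - j)‖) := by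
        rw [Finset.mul_sum]
        refine Finset.sum_le_sum fun j hj => ?_
        have hj := Finset.mem_range.1 hj
        have hnj : (j : ℝ) ≤ n := by exact_mod_cast hj.le
        have h1 : 1 + (n : ℝ) ≤ (1 + j) * (1 + |((n - j : ℤ) : ℝ)|) := by
          push_cast
          rw [abs_of_nonneg (by linarith)]
          nlinarith [(Nat.cast_nonneg j : (0 : ℝ) ≤ j)]
        calc (1 + (n : ℝ)) ^ k * (‖expCoeff d j‖ * ‖d (n - j)‖)
            ≤ ((1 + j) * (1 + |((n - j : ℤ) : ℝ)|)) ^ k * (‖expCoeff d j‖ * ‖d (n - j)‖) := by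
              gcongr
          _ = (1 + (j : ℝ)) ^ k * ‖expCoeff d j‖ *
              ((1 + |((n - j : ℤ) : ℝ)|) ^ k * ‖d (n - j)‖) := by
              rw [mul_pow]
              ring
          _ ≤ _ := by
              gcongr
              exact hK j hj
    _ ≤ K * ∑' m : ℤ, (1 + |(m : ℝ)|) ^ k * ‖d m‖ := by
        rw [← Finset.mul_sum]
        gcongr
        have hi : Set.InjOn (fun j : ℕ => (n - j : ℤ)) (Finset.range n) := by
          intro i _ j _ h
          simp only at h
          lia
        rw [← Finset.sum_image (f := fun m : ℤ => (1 + |(m : ℝ)|) ^ k * ‖d m‖) hi]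
        exact hs.sum_le_tsum _ fun _ _ => by positivity

theorem exists_expCoeff_bound [NormedAlgebra ℂ A] (d : WienerAlgebra A) (k : ℕ) :
    ∃ K, ∀ n : ℕ, (1 + (n : ℝ)) ^ k * ‖expCoeff d n‖ ≤ K := by
  induction k with
  | zero =>
    obtain ⟨N, hN⟩ := exists_nat_ge (∑' m : ℤ, (1 + |(m : ℝ)|) ^ 0 * ‖d m‖)
    refine ⟨∑ j ∈ Finset.range (N + 1), ‖expCoeff d j‖, fun n => ?_⟩
    have hK : 0 ≤ ∑ j ∈ Finset.range (N + 1), ‖expCoeff d j‖ := by positivity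
    induction n using Nat.strong_induction_on with
    | _ n ih =>
      rcases lt_or_ge n (N + 1) with hn | hn
      · rw [pow_zero, one_mul]
        exact Finset.single_le_sum (f := fun j => ‖expCoeff d j‖) (fun _ _ => norm_nonneg _)
          (Finset.mem_range.2 hn)
      · have hn0 : (0 : ℝ) < n := by exact_mod_cast (by lia : 0 < n)
        have hNn : (N : ℝ) ≤ n := by exact_mod_cast (by lia : N ≤ n)
        refine le_of_mul_le_mul_left ((norm_expCoeff_le d 0 n hK ih).trans ?_) hn0
        rw [mul_comm (n : ℝ)]
        exact mul_le_mul_of_nonneg_left (hN.trans hNn) hK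
  | succ k ih =>
    obtain ⟨K, hK⟩ := ih
    refine ⟨K * (∑' m : ℤ, (1 + |(m : ℝ)|) ^ k * ‖d m‖) + K, fun n => ?_⟩
    have hK0 : 0 ≤ K := le_trans (by positivity) (hK 0)
    calc _ = n * ((1 + (n : ℝ)) ^ k * ‖expCoeff d n‖) + (1 + (n : ℝ)) ^ k * ‖expCoeff d n‖ := by
          ring
      _ ≤ _ := add_le_add (norm_expCoeff_le d k n hK0 fun j _ => hK j) (hK n)

theorem orthogonalSeq_of_deriv [NormedAlgebra ℂ A] {u : WienerAlgebra A} {w : A}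
    (hu : u.deriv = const w * u) : OrthogonalSeq (u : ℤ → A) := by
  intro n m hnm
  have h (k : ℤ) : (k : ℂ) • u k = w * u k := by
    rw [← const_mul_apply, ← hu, deriv_apply]
  have hne : (n : ℂ) - m ≠ 0 := sub_ne_zero.2 (by exact_mod_cast hnm)
  refine (smul_eq_zero_iff_right hne).1 ?_
  rw [sub_smul, ← smul_mul_assoc, ← mul_smul_comm, h, h]
  ring

variable [CompleteSpace A]

noncomputable instance : CommRing (WienerAlgebra A) where
  add_assoc f g h := ext fun _ => add_assoc _ _ _
  add_comm f g := ext fun _ => add_comm _ _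
  zero_add f := ext fun _ => zero_add _
  add_zero f := ext fun _ => add_zero _
  neg_add_cancel f := ext fun _ => neg_add_cancel _
  nsmul := nsmulRec
  zsmul := zsmulRec
  mul_assoc f g h := ext (congrFun (conv_assoc f.2 g.2 h.2))
  mul_comm f g := ext (congrFun (conv_comm _ _))
  one_mul f := ext fun n => by
    change ∑' m : ℤ, (if m = 0 then (1 : A) else 0) * f (n - m) = f n
    rw [tsum_eq_single 0 fun m hm => by simp [hm]]
    simp
  mul_one f := ext fun n => by
    change ∑' m : ℤ, f m * (if n - m = 0 then (1 : A) else 0) = f n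
    rw [tsum_eq_single n fun m hm => by simp [sub_eq_zero, hm.symm]]
    simp
  zero_mul f := ext fun n => by
    change ∑' m : ℤ, (0 : A) * f (n - m) = 0
    simp
  mul_zero f := ext fun n => by
    change ∑' m : ℤ, f m * (0 : A) = 0
    simp
  left_distrib f g h := ext fun n => by
    change ∑' m : ℤ, f m * (g (n - m) + h (n - m)) = conv f g n + conv f h n
    simp_rw [mul_add]
    exact (f.2.summable_conv g.2 n).tsum_add (f.2.summable_conv h.2 n)
  right_distrib f g h := ext fun n => by
    change ∑' m : ℤ, (f m + g m) * h (n - m) = conv f h n + conv g h n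
    simp_rw [add_mul]
    exact (f.2.summable_conv h.2 n).tsum_add (g.2.summable_conv h.2 n)

theorem isWienerUnit {f : WienerAlgebra A} (hf : IsUnit f) : IsWienerUnit (f : ℤ → A) := by
  obtain ⟨g, hg⟩ := hf.exists_right_inv
  exact ⟨f.2, g, g.2, congrArg toFun hg⟩

variable [NormedAlgebra ℂ A]

theorem deriv_mul (f g : WienerAlgebra A) : (f * g).deriv = f.deriv * g + f * g.deriv := by
  ext n
  rw [deriv_apply, add_apply, mul_apply, mul_apply, mul_apply,
    ← (f.deriv.2.summable_conv g.2 n).tsum_add (f.2.summable_conv g.deriv.2 n),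
    ← (f.2.summable_conv g.2 n).tsum_const_smul]
  refine tsum_congr fun m => ?_
  rw [deriv_apply, deriv_apply, smul_mul_assoc, mul_smul_comm, ← add_smul]
  push_cast
  ring_nf

theorem exists_deriv_eq_mul {d : WienerAlgebra A} (hd : ∀ n ≤ 0, d n = 0) :
    ∃ y : WienerAlgebra A, y 0 = 1 ∧ (∀ n < 0, y n = 0) ∧ y.deriv = d * y := by
  have hy : RapidlyDecreasing fun n : ℤ => if n < 0 then 0 else expCoeff d n.toNat := by
    intro k
    obtain ⟨K, hK⟩ := exists_expCoeff_bound d k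
    have hK0 : 0 ≤ K := le_trans (by positivity) (hK 0)
    refine ⟨K, fun n => ?_⟩
    rcases lt_or_ge n 0 with hn | hn
    · simpa [hn] using hK0
    · lift n to ℕ using hn
      simpa [(Int.natCast_nonneg n).not_gt] using hK n
  obtain ⟨y, hyn, hy⟩ : ∃ y : WienerAlgebra A, (∀ n < 0, y n = 0) ∧
      ∀ n : ℕ, y n = expCoeff d n :=
    ⟨⟨_, hy⟩, fun n hn => if_pos hn, fun n => by
      simp [(Int.natCast_nonneg n).not_gt]⟩
  refine ⟨y, by simpa [expCoeff] using hy 0, hyn, ?_⟩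
  rw [mul_comm]
  ext n
  rw [deriv_apply, mul_apply]
  rcases lt_or_ge n 0 with hn | hn
  · rw [hyn n hn, smul_zero, tsum_congr (g := fun _ => (0 : A)), tsum_zero]
    intro m
    rcases lt_or_ge m 0 with hm | hm
    · rw [hyn m hm, zero_mul]
    · rw [hd _ (by lia), mul_zero]
  · lift n to ℕ using hn
    have hi : Set.InjOn (fun j : ℕ => (j : ℤ)) (Finset.range n) := fun i _ j _ h => by
      simpa using h
    rw [tsum_eq_sum (s := (Finset.range n).image fun j : ℕ => (j : ℤ)), Finset.sum_image hi]
    · simpa [hy] using smul_expCoeff d n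
    · intro m hm
      rcases lt_or_ge m 0 with hm0 | hm0
      · rw [hyn m hm0, zero_mul]
      · rw [hd, mul_zero]
        by_contra h
        refine hm (Finset.mem_image.2 ⟨m.toNat, Finset.mem_range.2 ?_, ?_⟩) <;> lia

theorem exists_unit_deriv_eq_mul {d : WienerAlgebra A} (hd : ∀ n ≤ 0, d n = 0) :
    ∃ y z : WienerAlgebra A, y * z = 1 ∧ y 0 = 1 ∧ (∀ n < 0, y n = 0) ∧
      z.deriv = -(d * z) := by
  obtain ⟨y, hy0, hyn, hy⟩ := exists_deriv_eq_mul hd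
  obtain ⟨z, hz0, hzn, hz⟩ := exists_deriv_eq_mul (d := -d) fun n hn => by simp [hd n hn]
  refine ⟨y, z, ?_, hy0, hyn, by rw [hz, neg_mul]⟩
  have h : (y * z).deriv = 0 := by
    rw [deriv_mul, hy, hz]
    ring
  ext n
  rw [one_apply]
  split_ifs with hn
  · rw [hn, mul_apply_zero_of_neg hyn hzn, hy0, hz0, one_mul]
  · have hn' : (n : ℂ) ≠ 0 := by exact_mod_cast hn
    have h' : (n : ℂ) • (y * z) n = 0 := congrArg (fun f : WienerAlgebra A => f n) h
    exact (smul_eq_zero_iff_right hn').1 h'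

end WienerAlgebra

open WienerAlgebra hiding ext

/-- Every unit of the Wiener algebra `W(A)` over a commutative complex
Banach algebra `A` factors as `a = a⁻ * ã * a⁺` with `a⁻` a strictly antiholomorphic
unit, `ã` an orthogonal unit, and `a⁺` a strictly holomorphic unit of `W(A)`. -/
theorem wiener_hopf_exists {A : Type*} [NormedCommRing A] [NormedAlgebra ℂ A]
    [CompleteSpace A] (a : ℤ → A) (ha : IsWienerUnit a) :
    ∃ aminus atil aplus : ℤ → A,
      IsWienerUnit aminus ∧ StrictlyAntiholomorphic aminus ∧
      IsWienerUnit atil ∧ OrthogonalSeq atil ∧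
      IsWienerUnit aplus ∧ StrictlyHolomorphic aplus ∧
      a = conv aminus (conv atil aplus) := by
  obtain ⟨ha, b, hb, hab⟩ := ha
  obtain ⟨a, rfl⟩ : ∃ f : WienerAlgebra A, f = a := ⟨⟨a, ha⟩, rfl⟩
  obtain ⟨b, rfl⟩ : ∃ f : WienerAlgebra A, f = b := ⟨⟨b, hb⟩, rfl⟩
  replace hab : a * b = 1 := WienerAlgebra.ext (congrFun hab)
  have hc := posPart_add_reflect_posPart (a.deriv * b)
  set c := a.deriv * b with hc_def
  have hpos (f : WienerAlgebra A) : ∀ n ≤ 0, f.posPart n = 0 := fun n hn => if_neg hn.not_gt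
  obtain ⟨p, p', hp, hp0, hpn, hp'⟩ := exists_unit_deriv_eq_mul (hpos c)
  obtain ⟨q, q', hq, hq0, hqn, hq'⟩ := exists_unit_deriv_eq_mul
    (d := -c.reflect.posPart) fun n hn => by simp [hpos _ n hn]
  have hqr : q.reflect * q'.reflect = 1 := by rw [← reflect_mul, hq, reflect_one]
  have hq'r : q'.reflect.deriv = -(c.reflect.posPart.reflect * q'.reflect) := by
    rw [deriv_reflect, hq', neg_mul, neg_neg, reflect_mul]
  refine ⟨q.reflect, (a * p' * q'.reflect : WienerAlgebra A), p,
    isWienerUnit (.of_mul_eq_one _ hqr),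
    ⟨by simpa using hq0, fun n hn => hqn (-n) (by lia)⟩,
    isWienerUnit (((IsUnit.of_mul_eq_one _ hab).mul (.of_mul_eq_one_right _ hp)).mul
      (.of_mul_eq_one_right _ hqr)), orthogonalSeq_of_deriv (w := c 0) ?_,
    isWienerUnit (.of_mul_eq_one _ hp), ⟨hp0, hpn⟩, ?_⟩
  · have hda : a.deriv = c * a := by
      rw [hc_def]
      linear_combination (-a.deriv) * hab
    rw [WienerAlgebra.deriv_mul, WienerAlgebra.deriv_mul, hda, hp', hq'r]
    linear_combination (-(a * p' * q'.reflect)) * hc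
  · refine congrArg toFun (?_ : a = q.reflect * (a * p' * q'.reflect * p))
    linear_combination (-a) * hp - a * p * p' * hqr
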